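/- Let D be a digraph, T an out-tree of D, L a set of vertices of D containing no internal vertex of T, and x a leaf of T not in L. Suppose λ(D, T, L ∪ {x}) ≥ 1, and suppose there exists a (T,L)-out-branching T' of D with λ(D,T,L) leaves such that the maximal subtree of T' rooted at x has exactly one leaf. Then λ(D, T, L) = λ(D, T, L ∪ {x}). -/

import Mathlib

/-- `T` is an out-tree of the digraph `D` with vertex set `S`, rooted at `r`:
an oriented subtree of `D` in which every vertex of `S` is reachable from `r`,
every vertex of `S` other than `r` has a unique in-neighbour (in-degree one),
and `r` is the unique vertex of in-degree zero. -/
structure IsOutTree {V : Type*} (D : V → V → Prop) (S : Set V) (T : V → V → Prop)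
    (r : V) : Prop where
  subgraph : ∀ ⦃a b : V⦄, T a b → D a b
  mem_left : ∀ ⦃a b : V⦄, T a b → a ∈ S
  mem_right : ∀ ⦃a b : V⦄, T a b → b ∈ S
  root_mem : r ∈ S
  reach : ∀ v ∈ S, Relation.ReflTransGen T r v
  unique_pred : ∀ v ∈ S, v ≠ r → ∃! u : V, T u v
  root_no_pred : ∀ u : V, ¬ T u r

/-- An out-branching of `D` is a spanning out-tree. -/
def IsOutBranching {V : Type*} (D T : V → V → Prop) (r : V) : Prop :=
  IsOutTree D Set.univ T r

/-- A leaf of an out-tree with arc relation `T` and vertex set `S`: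
a vertex of `S` of out-degree zero. -/
def IsTreeLeaf {V : Type*} (T : V → V → Prop) (S : Set V) (v : V) : Prop :=
  v ∈ S ∧ ∀ u : V, ¬ T v u

/-- The number of leaves of an out-tree with arc relation `T` and vertex set `S`. -/
noncomputable def numLeaves {V : Type*} (T : V → V → Prop) (S : Set V) : ℕ :=
  {v | IsTreeLeaf T S v}.ncard

/-- An internal vertex of an out-tree: a vertex of the tree that is not a leaf. -/
def IsInternal {V : Type*} (T : V → V → Prop) (S : Set V) (v : V) : Prop :=
  v ∈ S ∧ ∃ u : V, T v u

/-- A `(T,L)`-out-branching of `D` (for an out-tree `T` rooted at `r`):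
an out-branching of `D` rooted at `r` whose arc set contains the arcs of `T`
and in which every vertex of `L` is a leaf. -/
def IsTLOutBranching {V : Type*} (D T : V → V → Prop) (r : V) (L : Set V)
    (T' : V → V → Prop) : Prop :=
  IsOutBranching D T' r ∧ (∀ ⦃a b : V⦄, T a b → T' a b) ∧
    ∀ v ∈ L, IsTreeLeaf T' Set.univ v

/-- `λ(D,T,L)`: the maximum number of leaves over all `(T,L)`-out-branchings of `D`
(`0` if there is none). -/
noncomputable def maxLeafTL {V : Type*} (D T : V → V → Prop) (r : V) (L : Set V) : ℕ :=
  sSup {n | ∃ T' : V → V → Prop, IsTLOutBranching D T r L T' ∧ numLeaves T' Set.univ = n}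

/-- `D̂(T,L)`: the digraph obtained from `D` by deleting all arcs leaving vertices of `L`
and all arcs not in `A(T)` that enter a vertex of `V(T) = S`. -/
def Dhat {V : Type*} (D T : V → V → Prop) (S L : Set V) : V → V → Prop :=
  fun a b => D a b ∧ a ∉ L ∧ (b ∈ S → T a b)

open Relation

namespace IsOutTree

variable {V : Type*} {D T : V → V → Prop} {S : Set V} {r : V}

lemma pred_unique (h : IsOutTree D S T r) {a b c : V} (hac : T a c) (hbc : T b c) : a = b := by
  have hc : c ≠ r := by
    rintro rfl
    exact h.root_no_pred a hac
  exact (h.unique_pred c (h.mem_right hac) hc).unique hac hbc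

lemma not_transGen_self (h : IsOutTree D S T r) (v : V) : ¬ TransGen T v v := by
  intro hv
  have hvS : v ∈ S := by
    obtain ⟨b, -, hb⟩ := TransGen.tail'_iff.1 hv
    exact h.mem_right hb
  revert hv
  induction h.reach v hvS with
  | refl =>
    intro hv
    obtain ⟨b, -, hb⟩ := TransGen.tail'_iff.1 hv
    exact h.root_no_pred b hb
  | @tail b c _ hbc ih =>
    intro hc
    obtain ⟨d, hcd, hdc⟩ := TransGen.tail'_iff.1 hc
    obtain rfl := h.pred_unique hdc hbc
    exact ih (h.mem_left hbc) (TransGen.head' hbc hcd)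

lemma exists_leaf_descendant [Finite V] (h : IsOutTree D S T r) (a : V) :
    ∃ v, ReflTransGen T a v ∧ ∀ u, ¬ T v u := by
  have wf : WellFounded (fun a b => TransGen T b a) := by
    have : IsTrans V (fun a b => TransGen T b a) := ⟨fun _ _ _ hab hbc => hbc.trans hab⟩
    have : Std.Irrefl (fun a b => TransGen T b a) := ⟨h.not_transGen_self⟩
    exact Finite.wellFounded_of_trans_of_irrefl _
  obtain ⟨v, hv, hmin⟩ := wf.has_min {v | ReflTransGen T a v} ⟨a, ReflTransGen.refl⟩
  exact ⟨v, hv, fun u hu => hmin u (ReflTransGen.tail hv hu) (TransGen.single hu)⟩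

lemma comparable_of_common_descendant (h : IsOutTree D S T r) {a b l : V}
    (ha : ReflTransGen T a l) (hb : ReflTransGen T b l) :
    ReflTransGen T a b ∨ ReflTransGen T b a := by
  induction ha with
  | refl => exact Or.inr hb
  | @tail c d hac hcd ih =>
    rcases ReflTransGen.cases_tail hb with rfl | ⟨e, hbe, hed⟩
    · exact Or.inl (hac.tail hcd)
    · obtain rfl := h.pred_unique hed hcd
      exact ih hbe

lemma eq_of_sibling_reach (h : IsOutTree D S T r) {w a b : V} (ha : T w a) (hb : T w b)
    (hab : ReflTransGen T a b) : a = b := by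
  rcases ReflTransGen.cases_tail hab with rfl | ⟨e, hae, heb⟩
  · rfl
  · obtain rfl := h.pred_unique heb hb
    exact absurd (TransGen.head' ha hae) (h.not_transGen_self _)

/-- A subtree with a single leaf is a path: no vertex of it has two children. -/
lemma child_unique_of_ncard_leaves_eq_one [Finite V] (h : IsOutTree D S T r) {x : V}
    (hx : {v | ReflTransGen T x v ∧ ∀ u : V, ¬ T v u}.ncard = 1) {w a b : V}
    (hw : ReflTransGen T x w) (ha : T w a) (hb : T w b) : a = b := by
  obtain ⟨l, hl⟩ := Set.ncard_eq_one.1 hx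
  obtain ⟨p, hap, hp⟩ := h.exists_leaf_descendant a
  obtain ⟨q, hbq, hq⟩ := h.exists_leaf_descendant b
  have hpl : p = l := by
    have : p ∈ {v | ReflTransGen T x v ∧ ∀ u : V, ¬ T v u} := ⟨(hw.tail ha).trans hap, hp⟩
    rwa [hl] at this
  have hql : q = l := by
    have : q ∈ {v | ReflTransGen T x v ∧ ∀ u : V, ¬ T v u} := ⟨(hw.tail hb).trans hbq, hq⟩
    rwa [hl] at this
  subst hpl hql
  rcases h.comparable_of_common_descendant hap hbq with hab | hba
  · exact h.eq_of_sibling_reach ha hb hab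
  · exact (h.eq_of_sibling_reach hb ha hba).symm

end IsOutTree

/-- The arc relation obtained from `T` by replacing all arcs entering `y` by the arc `u y`. -/
def reattach {V : Type*} (T : V → V → Prop) (u y : V) : V → V → Prop :=
  fun a b => (b = y ∧ a = u) ∨ (b ≠ y ∧ T a b)

lemma IsOutBranching.reattach {V : Type*} {D T : V → V → Prop} {r u y : V}
    (h : IsOutBranching D T r) (hy : y ≠ r) (huy : D u y) (hu : ¬ ReflTransGen T y u) :
    IsOutBranching D (reattach T u y) r := by
  have avoid : ∀ v, ReflTransGen T r v → ¬ ReflTransGen T y v →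
      ReflTransGen (_root_.reattach T u y) r v := by
    intro v hv
    induction hv with
    | refl => exact fun _ => ReflTransGen.refl
    | @tail b c _ hbc ih =>
      intro hc
      refine (ih fun hb => hc (hb.tail hbc)).tail (Or.inr ⟨?_, hbc⟩)
      rintro rfl
      exact hc ReflTransGen.refl
  have reach_y : ReflTransGen (_root_.reattach T u y) r y :=
    (avoid u (h.reach u trivial) hu).tail (Or.inl ⟨rfl, rfl⟩)
  refine ⟨?_, fun _ _ _ => trivial, fun _ _ _ => trivial, trivial, ?_, ?_, ?_⟩
  · rintro a b (⟨rfl, rfl⟩ | ⟨-, hab⟩)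
    · exact huy
    · exact h.subgraph hab
  · intro v hv
    induction h.reach v hv with
    | refl => exact ReflTransGen.refl
    | @tail b c _ hbc ih =>
      by_cases hc : c = y
      · exact hc ▸ reach_y
      · exact (ih trivial).tail (Or.inr ⟨hc, hbc⟩)
  · intro v hv hvr
    by_cases hvy : v = y
    · refine ⟨u, Or.inl ⟨hvy, rfl⟩, ?_⟩
      rintro a (⟨-, ha⟩ | ⟨hne, -⟩)
      · exact ha
      · exact absurd hvy hne
    · obtain ⟨p, hp, hp'⟩ := h.unique_pred v hv hvr
      refine ⟨p, Or.inr ⟨hvy, hp⟩, ?_⟩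
      rintro a (⟨he, -⟩ | ⟨-, ha⟩)
      · exact absurd he hvy
      · exact hp' a ha
  · rintro a (⟨he, -⟩ | ⟨-, ha⟩)
    · exact hy he.symm
    · exact h.root_no_pred a ha

lemma numLeaves_le_reattach {V : Type*} [Finite V] {T : V → V → Prop} {u w y : V}
    (hwy : T w y) (hw : ∀ c, T w c → c = y) (huw : w ≠ u) :
    numLeaves T Set.univ ≤ numLeaves (reattach T u y) Set.univ := by
  have hsub : insert w ({v | IsTreeLeaf T Set.univ v} \ {u}) ⊆
      {v | IsTreeLeaf (reattach T u y) Set.univ v} := by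
    rintro v (rfl | ⟨⟨-, hv⟩, hvu⟩)
    · refine ⟨trivial, ?_⟩
      rintro c (⟨-, h⟩ | ⟨hc, h⟩)
      · exact huw h
      · exact hc (hw c h)
    · refine ⟨trivial, ?_⟩
      rintro c (⟨-, h⟩ | ⟨-, h⟩)
      · exact hvu h
      · exact hv c h
  have hnot : w ∉ {v | IsTreeLeaf T Set.univ v} \ {u} := fun h => h.1.2 y hwy
  calc numLeaves T Set.univ ≤ ({v | IsTreeLeaf T Set.univ v} \ {u}).ncard + 1 :=
        Nat.sub_le_iff_le_add.1 (Set.pred_ncard_le_ncard_sdiff_singleton _ _)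
    _ = (insert w ({v | IsTreeLeaf T Set.univ v} \ {u})).ncard :=
        (Set.ncard_insert_of_notMem hnot (Set.toFinite _)).symm
    _ ≤ numLeaves (reattach T u y) Set.univ := Set.ncard_le_ncard hsub (Set.toFinite _)

/-- A path from outside `P` to a vertex of `P` contains an arc entering `P`. -/
lemma exists_arc_entering {V : Type*} {T : V → V → Prop} {P : V → Prop} {a b : V}
    (h : ReflTransGen T a b) (ha : ¬ P a) (hb : P b) : ∃ u y, T u y ∧ ¬ P u ∧ P y := by
  induction h with
  | refl => exact absurd hb ha
  | @tail c d _ hcd ih =>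
    by_cases hc : P c
    · exact ih hc
    · exact ⟨c, d, hcd, hc, hb⟩

/-- Proper descendants, in an out-branching extending `T`, of a leaf of `T` lie outside `T`. -/
lemma notMem_of_transGen_leaf {V : Type*} {D T T' : V → V → Prop} {S : Set V} {r x y : V}
    (hT : IsOutTree D S T r) (hT' : IsOutBranching D T' r) (hsub : ∀ ⦃a b⦄, T a b → T' a b)
    (hx : IsTreeLeaf T S x) (hxy : TransGen T' x y) : y ∉ S := by
  have pred : ∀ b c, T' b c → c ∈ S → T b c := by
    intro b c hbc hc
    have hcr : c ≠ r := by
      rintro rfl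
      exact hT'.root_no_pred b hbc
    obtain ⟨p, hp, -⟩ := hT.unique_pred c hc hcr
    exact hT'.pred_unique (hsub hp) hbc ▸ hp
  induction hxy with
  | single h => exact fun hy => hx.2 _ (pred _ _ h hy)
  | tail _ hbc ih => exact fun hc => ih (hT.mem_left (pred _ _ hbc hc))

/-- Given a `(T,L)`-out-branching whose subtree at `x` is a path, and some
`(T,L ∪ {x})`-out-branching, there is a `(T,L ∪ {x})`-out-branching with at least as many
leaves. -/
lemma exists_branching_with_leaf {V : Type*} [Finite V] {D T B : V → V → Prop} {S : Set V}
    {r : V} (hT : IsOutTree D S T r) {L : Set V} {x : V} (hx : IsTreeLeaf T S x)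
    (hB : IsTLOutBranching D T r (L ∪ {x}) B) (n : ℕ) :
    ∀ T' : V → V → Prop, {v | ReflTransGen T' x v}.ncard ≤ n → IsTLOutBranching D T r L T' →
      (∀ w a b, ReflTransGen T' x w → T' w a → T' w b → a = b) →
      ∃ T'', IsTLOutBranching D T r (L ∪ {x}) T'' ∧
        numLeaves T' Set.univ ≤ numLeaves T'' Set.univ := by
  induction n with
  | zero =>
    intro T' hn
    have hmem : x ∈ {v | ReflTransGen T' x v} := ReflTransGen.refl
    rw [Nat.le_zero, Set.ncard_eq_zero] at hn
    simp [hn] at hmem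
  | succ n ih =>
    intro T' hn hT' hpath
    obtain ⟨hbr, hsub, hleaf⟩ := hT'
    by_cases hxl : ∀ c, ¬ T' x c
    · refine ⟨T', ⟨hbr, hsub, ?_⟩, le_rfl⟩
      rintro v (hv | rfl)
      · exact hleaf v hv
      · exact ⟨trivial, hxl⟩
    push Not at hxl
    obtain ⟨c, hc⟩ := hxl
    have hroot : ¬ TransGen T' x r := by
      intro h
      obtain ⟨b, -, hb⟩ := TransGen.tail'_iff.1 h
      exact hbr.root_no_pred b hb
    obtain ⟨u, y, huy, hu, hy⟩ := exists_arc_entering (P := fun v => TransGen T' x v)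
      (hB.1.reach c trivial) hroot (TransGen.single hc)
    have hux : u ≠ x := by
      rintro rfl
      exact (hB.2.2 u (Or.inr rfl)).2 y huy
    have hu' : ¬ ReflTransGen T' x u := by
      rw [reflTransGen_iff_eq_or_transGen]
      exact not_or.2 ⟨hux, hu⟩
    have hyr : y ≠ r := by
      rintro rfl
      exact hroot hy
    have hyS : y ∉ S := notMem_of_transGen_leaf hT hbr hsub hx hy
    have hyx : y ≠ x := by
      rintro rfl
      exact hyS hx.1
    obtain ⟨w, hxw, hwy⟩ := TransGen.tail'_iff.1 hy
    have hdesc : ∀ v, ReflTransGen (reattach T' u y) x v → ReflTransGen T' x v := by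
      intro v hv
      induction hv with
      | refl => exact ReflTransGen.refl
      | tail _ hbc ih =>
        rcases hbc with ⟨-, rfl⟩ | ⟨-, h⟩
        · exact absurd ih hu'
        · exact ih.tail h
    have hynot : ¬ ReflTransGen (reattach T' u y) x y := by
      intro h
      rcases ReflTransGen.cases_tail h with h | ⟨b, hb, ⟨-, rfl⟩ | ⟨h, -⟩⟩
      · exact hyx h
      · exact hu' (hdesc _ hb)
      · exact h rfl
    have hlt : {v | ReflTransGen (reattach T' u y) x v}.ncard <
        {v | ReflTransGen T' x v}.ncard :=
      Set.ncard_lt_ncard ⟨hdesc, fun h => hynot (h hy.to_reflTransGen)⟩ (Set.toFinite _)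
    have hnew : IsTLOutBranching D T r L (reattach T' u y) := by
      refine ⟨hbr.reattach hyr (hB.1.subgraph huy)
        (fun h => hu' (hy.to_reflTransGen.trans h)), ?_, ?_⟩
      · refine fun a b hab => Or.inr ⟨?_, hsub hab⟩
        rintro rfl
        exact hyS (hT.mem_right hab)
      · refine fun v hv => ⟨trivial, ?_⟩
        rintro b (⟨-, rfl⟩ | ⟨-, h⟩)
        · exact (hB.2.2 v (Or.inl hv)).2 y huy
        · exact (hleaf v hv).2 b h
    have hchild : ∀ v b, ReflTransGen T' x v → reattach T' u y v b → T' v b := by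
      rintro v b hv (⟨-, rfl⟩ | ⟨-, h⟩)
      · exact absurd hv hu'
      · exact h
    obtain ⟨T'', hT'', hle⟩ := ih _ (by omega) hnew fun v a b hv ha hb =>
      hpath v a b (hdesc v hv) (hchild v a (hdesc v hv) ha) (hchild v b (hdesc v hv) hb)
    refine ⟨T'', hT'', le_trans (numLeaves_le_reattach hwy
      (fun c hc => hpath w c y hxw hc hwy) ?_) hle⟩
    rintro rfl
    exact hu' hxw

lemma numLeaves_le_maxLeafTL {V : Type*} [Finite V] {D T T' : V → V → Prop} {r : V} {L : Set V}
    (h : IsTLOutBranching D T r L T') : numLeaves T' Set.univ ≤ maxLeafTL D T r L := by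
  refine le_csSup ⟨Nat.card V, ?_⟩ ⟨T', h, rfl⟩
  rintro _ ⟨B, -, rfl⟩
  exact Set.ncard_le_card _

/-- If `λ(D,T,L ∪ {x}) ≥ 1` and some optimal `(T,L)`-out-branching `T'` is such that the
maximal subtree of `T'` rooted at the leaf `x` of `T` has exactly one leaf, then
`λ(D,T,L) = λ(D,T,L ∪ {x})`. -/
theorem maxLeaf_eq_of_subtree_single_leaf
    {V : Type*} [Fintype V] (D T : V → V → Prop) (S : Set V) (r : V)
    (hT : IsOutTree D S T r) (L : Set V)
    (hL : ∀ v ∈ L, ¬ IsInternal T S v)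
    (x : V) (hx : IsTreeLeaf T S x) (hxL : x ∉ L)
    (h1 : 1 ≤ maxLeafTL D T r (L ∪ {x}))
    (hopt : ∃ T' : V → V → Prop, IsTLOutBranching D T r L T' ∧
      numLeaves T' Set.univ = maxLeafTL D T r L ∧
      {v | Relation.ReflTransGen T' x v ∧ ∀ u : V, ¬ T' v u}.ncard = 1) :
    maxLeafTL D T r L = maxLeafTL D T r (L ∪ {x}) := by
  obtain ⟨T', hT', hopt', hone⟩ := hopt
  have hne : {n | ∃ B, IsTLOutBranching D T r (L ∪ {x}) B ∧ numLeaves B Set.univ = n}.Nonempty := by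
    rw [Set.nonempty_iff_ne_empty]
    intro h
    rw [maxLeafTL, h] at h1
    simp at h1
  apply le_antisymm
  · obtain ⟨_, B, hB, -⟩ := hne
    obtain ⟨T'', hT'', hle⟩ := exists_branching_with_leaf hT hx hB _ T' le_rfl hT'
      fun w a b hw ha hb => hT'.1.child_unique_of_ncard_leaves_eq_one hone hw ha hb
    rw [← hopt']
    exact hle.trans (numLeaves_le_maxLeafTL hT'')
  · refine csSup_le hne ?_
    rintro _ ⟨B, ⟨hbr, hsub, hleaf⟩, rfl⟩
    exact numLeaves_le_maxLeafTL ⟨hbr, hsub, fun v hv => hleaf v (Or.inl hv)⟩
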